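/- Under the standing assumptions, assume further x ≤ 80. If q is a prime divisor of m with q < 173, then q^3 does not divide x₁^(q−1) − y₁^(q−1). -/

import Mathlib

def gS (a b k : ℕ) : ℕ := ∑ i ∈ Finset.range k, a ^ i * b ^ (k - 1 - i)

lemma gS_mul {a b : ℕ} (h : b ≤ a) (k : ℕ) : gS a b k * (a - b) = a ^ k - b ^ k := by
  have h2 : b ^ k ≤ a ^ k := Nat.pow_le_pow_left h k
  zify [h, h2]
  unfold gS
  push_cast
  exact (Commute.all (a : ℤ) (b : ℤ)).geom_sum₂_mul k

lemma gS_scale (d a b k : ℕ) : gS (d * a) (d * b) k = d ^ (k - 1) * gS a b k := by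
  unfold gS
  rw [Finset.mul_sum]
  refine Finset.sum_congr rfl fun i hi => ?_
  have : k - 1 = i + (k - 1 - i) := by have := Finset.mem_range.1 hi; omega
  rw [mul_pow, mul_pow]
  conv_rhs => rw [this, pow_add]
  have h3 : i + (k - 1 - i) - i = k - 1 - i := by omega
  rw [h3]; ring

lemma gS_pos {a b k : ℕ} (hb : 0 < b) (ha : 0 < a) (hk : 0 < k) : 0 < gS a b k := by
  unfold gS
  exact Finset.sum_pos (fun i _ => by positivity) ⟨0, by simpa using hk⟩

lemma gS_gt {a b k : ℕ} (hb : 0 < b) (ha : 0 < a) (hk : 2 ≤ k) : a ^ (k - 1) < gS a b k := by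
  obtain ⟨j, rfl⟩ : ∃ j, k = j + 2 := ⟨k - 2, by omega⟩
  unfold gS
  rw [Finset.sum_range_succ]
  have : 0 < ∑ i ∈ Finset.range (j + 1), a ^ i * b ^ (j + 2 - 1 - i) :=
    Finset.sum_pos (fun i _ => by positivity) ⟨0, by simp⟩
  simp; simpa using this

lemma gS_comp {a b : ℕ} (h : b < a) {d : ℕ} (hd : 0 < d) (k : ℕ) :
    gS a b (d * k) = gS a b d * gS (a ^ d) (b ^ d) k := by
  have h1 := gS_mul h.le (d * k)
  have h2 := gS_mul h.le d
  have h3 := gS_mul (Nat.pow_le_pow_left h.le d) k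
  have : 0 < a - b := by omega
  apply Nat.eq_of_mul_eq_mul_right this
  rw [h1, mul_right_comm, h2, mul_comm (a ^ d - b ^ d), h3, pow_mul, pow_mul]

lemma gS_dvd {a b : ℕ} (h : b < a) {d m : ℕ} (hd : 0 < d) (hdm : d ∣ m) : gS a b d ∣ gS a b m := by
  obtain ⟨k, rfl⟩ := hdm
  rw [gS_comp h hd]; exact dvd_mul_right _ _

lemma gS_zmod {p a b : ℕ} (h : b ≤ a) (hp : p ∣ a - b) (k : ℕ) :
    (gS a b k : ZMod p) = k * (a : ZMod p) ^ (k - 1) := by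
  have e : (a : ZMod p) = b := by
    have := (ZMod.natCast_eq_zero_iff (a - b) p).2 hp
    rw [Nat.cast_sub h] at this
    exact sub_eq_zero.1 this
  unfold gS
  push_cast
  rw [← e]
  rw [Finset.sum_congr rfl (g := fun _ => (a : ZMod p) ^ (k - 1))]
  · simp
  · intro i hi
    rw [← pow_add]
    congr 1
    have := Finset.mem_range.1 hi; omega

lemma dvd_of_dvd_gS {p a b k : ℕ} (hp : p.Prime) (h : b ≤ a) (hab : p ∣ a - b) (ha : ¬ p ∣ a)
    (hk : p ∣ gS a b k) : p ∣ k := by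
  have := Fact.mk hp
  rw [← ZMod.natCast_eq_zero_iff, gS_zmod h hab] at hk
  rcases mul_eq_zero.1 hk with h1 | h1
  · exact (ZMod.natCast_eq_zero_iff _ _).1 h1
  · exact absurd ((ZMod.natCast_eq_zero_iff _ _).1 (eq_zero_of_pow_eq_zero h1)) ha

lemma dvd_gS_of_dvd {p a b k : ℕ} (h : b ≤ a) (hab : p ∣ a - b)
    (hk : p ∣ k) : p ∣ gS a b k := by
  rw [← ZMod.natCast_eq_zero_iff, gS_zmod h hab, (ZMod.natCast_eq_zero_iff _ _).2 hk, zero_mul]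

lemma not_dvd_of_dvd_sub {p a b k : ℕ} (hp : p.Prime) (hab : b < a) (hc : Nat.Coprime a b) (hk : 0 < k)
    (h : p ∣ a ^ k - b ^ k) : ¬ p ∣ a ∧ ¬ p ∣ b := by
  have h2 : b ^ k ≤ a ^ k := Nat.pow_le_pow_left hab.le k
  have key : p ∣ a ^ k ↔ p ∣ b ^ k := by
    constructor
    · intro h3; exact (Nat.dvd_sub_iff_right h2 h3).1 h
    · intro h3; have := dvd_add h h3; rwa [Nat.sub_add_cancel h2] at this
  have h0 : ¬ (p ∣ a ∧ p ∣ b) := fun ⟨h3, h4⟩ => Nat.not_coprime_of_dvd_of_dvd hp.one_lt h3 h4 hc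
  constructor
  · intro h3; exact h0 ⟨h3, hp.dvd_of_dvd_pow (key.1 (dvd_pow h3 hk.ne'))⟩
  · intro h3; exact h0 ⟨hp.dvd_of_dvd_pow (key.2 (dvd_pow h3 hk.ne')), h3⟩

/-- the order of a/b mod p -/
noncomputable def rord (a b p : ℕ) : ℕ := orderOf ((a : ZMod p) * (b : ZMod p)⁻¹)

lemma rord_dvd {p a b : ℕ} (hp : p.Prime) (hab : b < a) (hb : ¬ p ∣ b) (k : ℕ) :
    p ∣ a ^ k - b ^ k ↔ rord a b p ∣ k := by
  have := Fact.mk hp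
  have hb' : (b : ZMod p) ^ k ≠ 0 := pow_ne_zero _ (by rwa [Ne, ZMod.natCast_eq_zero_iff])
  have h2 : b ^ k ≤ a ^ k := Nat.pow_le_pow_left hab.le k
  rw [rord, ← div_eq_mul_inv, orderOf_dvd_iff_pow_eq_one, div_pow, div_eq_one_iff_eq hb', ← ZMod.natCast_eq_zero_iff,
    Nat.cast_sub h2, sub_eq_zero]
  push_cast; rfl

lemma rord_dvd_pred {p a b : ℕ} (hp : p.Prime) (ha : ¬ p ∣ a) (hb : ¬ p ∣ b) :
    rord a b p ∣ p - 1 := by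
  have := Fact.mk hp
  rw [rord, ← div_eq_mul_inv]
  apply ZMod.orderOf_dvd_card_sub_one
  apply div_ne_zero <;> rwa [Ne, ZMod.natCast_eq_zero_iff]

lemma totient_val {X r : ℕ} (hX : X ≠ 0) :
    X.factorization r + (X.primeFactors.filter (fun p => r ∣ p - 1)).card
      ≤ 1 + (Nat.totient X).factorization r ∨ ¬ r.Prime := by
  by_cases hr : r.Prime
  swap
  · right; exact hr
  left
  have h := congrArg (fun t => t.factorization r) (Nat.totient_mul_prod_primeFactors X)
  have hp : ∀ p ∈ X.primeFactors, p ≠ 0 := fun p hp => (Nat.prime_of_mem_primeFactors hp).ne_zero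
  have hp1 : ∀ p ∈ X.primeFactors, p - 1 ≠ 0 := fun p hp => by
    have := (Nat.prime_of_mem_primeFactors hp).two_le; omega
  beta_reduce at h
  rw [Nat.factorization_mul (Nat.totient_pos.2 (Nat.pos_of_ne_zero hX)).ne' (Finset.prod_ne_zero_iff.2 hp),
    Nat.factorization_mul hX (Finset.prod_ne_zero_iff.2 hp1), Nat.factorization_prod hp,
    Nat.factorization_prod hp1] at h
  simp only [Finsupp.add_apply, Finsupp.coe_finsetSum, Finset.sum_apply] at h
  have h1 : ∑ p ∈ X.primeFactors, p.factorization r ≤ 1 := by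
    rw [Finset.sum_congr rfl (g := fun p => if p = r then 1 else 0)]
    · rw [Finset.sum_ite_eq']; split_ifs <;> simp
    · intro p hp
      rw [(Nat.prime_of_mem_primeFactors hp).factorization, Finsupp.single_apply]
  have h2 : (X.primeFactors.filter (fun p => r ∣ p - 1)).card ≤ ∑ p ∈ X.primeFactors, (p - 1).factorization r := by
    rw [Finset.card_filter]
    refine Finset.sum_le_sum fun p hp => ?_
    split_ifs with h3
    · exact (hr.dvd_iff_one_le_factorization (hp1 p hp)).1 h3
    · simp
  omega
def oddPrimes : List ℕ := [3,5,7,11,13,17,19,23,29,31,37,41,43,47,53,59,61,67,71,73,79,83,89,97,101,103,107,109,113,127,131,137,139,149,151,157,163,167]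

def chkD (q x y k : ℕ) : ℕ :=
  Nat.mod (Nat.sub (Nat.pow x (Nat.sub q 1)) (Nat.pow y (Nat.sub q 1))) (Nat.pow q k)

/-- Uses the kernel-accelerated operations directly so that evaluation is fast. -/
def chk (q x y : ℕ) : Bool :=
  or (or (Nat.ble (Nat.mod x q) 0) (Nat.ble 1 (chkD q x y 3)))
    (and (Nat.ble 10 x) (or (Nat.ble 1 (chkD q x y 4))
      (and (Nat.ble 24 x) (Nat.ble 1 (chkD q x y 6)))))

lemma chkD_eq (q x y k : ℕ) : chkD q x y k = (x ^ (q - 1) - y ^ (q - 1)) % q ^ k := rfl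

lemma ble_one (t : ℕ) : Nat.ble 1 t = (t != 0) := by
  cases t <;> rfl

lemma chk_eq (q x y : ℕ) : chk q x y =
  ((x % q == 0) || ((x ^ (q - 1) - y ^ (q - 1)) % q ^ 3 != 0) ||
    (Nat.ble 10 x && (((x ^ (q - 1) - y ^ (q - 1)) % q ^ 4 != 0) ||
      (Nat.ble 24 x && ((x ^ (q - 1) - y ^ (q - 1)) % q ^ 6 != 0))))) := by
  have h : Nat.ble (Nat.mod x q) 0 = (x % q == 0) := by
    change Nat.ble (x % q) 0 = (x % q == 0)
    cases x % q <;> rfl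
  unfold chk
  rw [h]
  simp only [ble_one, chkD_eq]

set_option maxRecDepth 100000 in
lemma chk_all : (oddPrimes.all fun q => (List.range 81).all fun x => (List.range x).all fun y => chk q x y) = true := by
  decide +kernel

lemma mem_oddPrimes {q : ℕ} (hq : q.Prime) (h2 : q ≠ 2) (h : q < 173) : q ∈ oddPrimes := by
  interval_cases q <;> first | decide | (exfalso; revert hq; norm_num; done) | omega

lemma tot80 : ∀ z < 80, 4 * z ≤ 15 * Nat.totient z := by
  decide +kernel

def PP (a b m r : ℕ) : Finset ℕ := (gS a b m).primeFactors.filter (fun p => r ∣ p - 1)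

lemma dvd_sub_of_dvd_gS {a b k p : ℕ} (hab : b < a) (h : p ∣ gS a b k) : p ∣ a ^ k - b ^ k := by
  rw [← gS_mul hab.le]; exact dvd_mul_of_dvd_left h _

lemma mem_PP {a b m p l q : ℕ} (hb : 0 < b) (hab : b < a) (hc : Nat.Coprime a b) (hm : 0 < m)
    (hp : p.Prime) (h : p ∣ gS a b m) (ho : rord a b p = l) (hq : q ∣ l) : p ∈ PP a b m q := by
  have h1 := not_dvd_of_dvd_sub hp hab hc hm (dvd_sub_of_dvd_gS hab h)
  unfold PP
  rw [Finset.mem_filter, Nat.mem_primeFactors]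
  refine ⟨⟨hp, h, (gS_pos hb (by omega) hm).ne'⟩, ?_⟩
  exact (hq.trans (ho ▸ rord_dvd_pred hp h1.1 h1.2))

lemma exP {a b m r : ℕ} (hb : 0 < b) (hab : b < a) (hc : Nat.Coprime a b) (hm : 0 < m)
    (hr : r.Prime) (hrm : r ∣ m) (hv : (gS a b m).factorization r ≤ 1) :
    ∃ p ∈ PP a b m r, rord a b p = r := by
  have hpos : gS a b m ≠ 0 := (gS_pos hb (by omega) hm).ne'
  have hd := gS_dvd hab hr.pos hrm
  have hgt : r < gS a b r := by
    have h1 := gS_gt hb (by omega : 0 < a) hr.two_le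
    have h2 : 2 ^ (r - 1) ≤ a ^ (r - 1) := Nat.pow_le_pow_left (by omega) _
    have h3 : r - 1 < 2 ^ (r - 1) := Nat.lt_two_pow_self
    omega
  have hposr : gS a b r ≠ 0 := by omega
  obtain ⟨p, hp, hpd, hpr⟩ : ∃ p, p.Prime ∧ p ∣ gS a b r ∧ p ≠ r := by
    by_contra hcon
    push Not at hcon
    have h4 := Nat.eq_prime_pow_of_unique_prime_dvd hposr (fun {d} h1 h2 => hcon d h1 h2)
    set k := (gS a b r).primeFactorsList.length
    have h5 : r ^ k ∣ gS a b m := h4 ▸ hd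
    have h6 := (hr.pow_dvd_iff_le_factorization hpos).1 h5
    have h7 : r ^ k ≤ r ^ 1 := Nat.pow_le_pow_right hr.pos (by omega)
    rw [← h4, pow_one] at h7; omega
  have hps := dvd_sub_of_dvd_gS hab hpd
  have hn := not_dvd_of_dvd_sub hp hab hc hr.pos hps
  have ho : rord a b p = r := by
    rcases (Nat.dvd_prime hr).1 ((rord_dvd hp hab hn.2 r).1 hps) with h1 | h1
    · exfalso
      have h2 : p ∣ a - b := by simpa using (rord_dvd hp hab hn.2 1).2 (by rw [h1])
      exact hpr ((Nat.prime_dvd_prime_iff_eq hp hr).1 (dvd_of_dvd_gS hp hab.le h2 hn.1 hpd))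
    · exact h1
  exact ⟨p, mem_PP hb hab hc hm hp (hpd.trans hd) ho dvd_rfl, ho⟩

/-- no prime factor of `m` divides `a^m - b^m` -/
lemma C1 {a b m n : ℕ} (hb : 0 < b) (hab : b < a) (hc : Nat.Coprime a b) (hm : 0 < m) (hn : 0 < n)
    (hmn : Nat.Coprime m n)
    (K : ∀ r, r.Prime → (PP a b m r).card + (gS a b m).factorization r ≤ 1 + (gS a b n).factorization r)
    {r : ℕ} (hr : r.Prime) (hrm : r ∣ m) : ¬ r ∣ a ^ m - b ^ m := by
  intro h
  have hnd := not_dvd_of_dvd_sub hr hab hc hm h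
  have hposm : gS a b m ≠ 0 := (gS_pos hb (by omega) hm).ne'
  have h0 : (gS a b n).factorization r = 0 := by
    apply Nat.factorization_eq_zero_of_not_dvd
    intro h1
    have h2 := (rord_dvd hr hab hnd.2 _).1 (dvd_sub_of_dvd_gS hab h1)
    have h3 := (rord_dvd hr hab hnd.2 _).1 h
    have h4 := Nat.dvd_gcd h3 h2
    rw [hmn.gcd_eq_one] at h4
    have h5 : r ∣ a - b := by simpa using (rord_dvd hr hab hnd.2 1).2 h4
    exact Nat.not_coprime_of_dvd_of_dvd hr.one_lt hrm (dvd_of_dvd_gS hr hab.le h5 hnd.1 h1) hmn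
  have h1 : 1 ≤ (gS a b m).factorization r := by
    rw [← hr.dvd_iff_one_le_factorization hposm]
    by_cases h5 : r ∣ a - b
    · exact dvd_gS_of_dvd hab.le h5 hrm
    · rw [← gS_mul hab.le] at h
      exact (hr.dvd_mul.1 h).resolve_right h5
  have h2 := K r hr
  obtain ⟨p, hp, -⟩ := exP hb hab hc hm hr hrm (by omega)
  have := Finset.card_pos.2 ⟨p, hp⟩
  omega

lemma exP2 {a b m : ℕ} (hb : 0 < b) (hab : b < a) (hc : Nat.Coprime a b) (hm : 0 < m)
    (C : ∀ r, r.Prime → r ∣ m → ¬ r ∣ a ^ m - b ^ m)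
    {q r : ℕ} (hq : q.Prime) (hqm : q ∣ m) (hr : r.Prime) (hrm : r ∣ m) (hqr : q ≠ r) :
    ∃ p ∈ PP a b m q, rord a b p = q * r := by
  have ha : 0 < a := by omega
  have hdm : r * q ∣ m :=
    Nat.Coprime.mul_dvd_of_dvd_of_dvd ((Nat.coprime_primes hr hq).2 (Ne.symm hqr)) hrm hqm
  have hT : gS (a ^ r) (b ^ r) q ∣ gS a b m := by
    refine dvd_trans ?_ (gS_dvd hab (Nat.mul_pos hr.pos hq.pos) hdm)
    rw [gS_comp hab hr.pos]; exact dvd_mul_left _ _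
  have haq : b ^ q < a ^ q := Nat.pow_lt_pow_left hab hq.ne_zero
  have har : b ^ r < a ^ r := Nat.pow_lt_pow_left hab hr.ne_zero
  have hnc : ¬ Nat.Coprime (gS (a ^ r) (b ^ r) q) (gS (a ^ q) (b ^ q) r) := by
    intro hco
    have e1 := gS_mul har.le q
    have e2 := gS_mul haq.le r
    rw [← pow_mul, ← pow_mul, mul_comm r q, pow_mul a, pow_mul b, ← e2] at e1
    have h1 : gS (a ^ r) (b ^ r) q ∣ a ^ q - b ^ q := by
      apply hco.dvd_of_dvd_mul_left
      rw [← e1]; exact dvd_mul_right _ _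
    have h2 := Nat.le_of_dvd (by omega) h1
    have h3 := gS_gt (a := a ^ r) (b := b ^ r) (by positivity) (by positivity) hq.two_le
    rw [← pow_mul] at h3
    have h4 : a ^ q ≤ a ^ (r * (q - 1)) := by
      apply Nat.pow_le_pow_right ha
      have := hq.two_le; have := hr.two_le
      obtain ⟨j, rfl⟩ : ∃ j, q = j + 2 := ⟨q - 2, by omega⟩
      have : 2 * (j + 1) ≤ r * (j + 1) := Nat.mul_le_mul_right _ hr.two_le
      simp; omega
    omega
  obtain ⟨p, hp, hp1, hp2⟩ := Nat.Prime.not_coprime_iff_dvd.1 hnc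
  have hpm := hp1.trans hT
  have hpd := dvd_sub_of_dvd_gS hab hpm
  have hn := not_dvd_of_dvd_sub hp hab hc hm hpd
  have hpnm : ¬ p ∣ m := fun h => C p hp h hpd
  have o1 : ¬ rord a b p ∣ q := by
    rw [← rord_dvd hp hab hn.2]
    intro h
    exact hpnm ((dvd_of_dvd_gS hp haq.le h (fun h => hn.1 (hp.dvd_of_dvd_pow h)) hp2).trans hrm)
  have o2 : ¬ rord a b p ∣ r := by
    rw [← rord_dvd hp hab hn.2]
    intro h
    exact hpnm ((dvd_of_dvd_gS hp har.le h (fun h => hn.1 (hp.dvd_of_dvd_pow h)) hp1).trans hqm)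
  have o3 : rord a b p ∣ q * r := by
    rw [← rord_dvd hp hab hn.2, mul_comm, pow_mul, pow_mul]
    exact dvd_sub_of_dvd_gS har hp1
  have ho : rord a b p = q * r := by
    obtain ⟨k1, k2, h1, h2, h3⟩ := (Nat.dvd_mul).1 o3
    rcases (Nat.dvd_prime hq).1 h1 with rfl | rfl
    · exact absurd (by rw [← h3, one_mul]; exact h2) o2
    · rcases (Nat.dvd_prime hr).1 h2 with rfl | rfl
      · exact absurd (by rw [← h3, mul_one]) o1
      · exact h3.symm
  exact ⟨p, mem_PP hb hab hc hm hp hpm ho (dvd_mul_right _ _), ho⟩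

lemma card_PP_ge {a b m : ℕ} (hb : 0 < b) (hab : b < a) (hc : Nat.Coprime a b) (hm : 0 < m)
    (C : ∀ r, r.Prime → r ∣ m → ¬ r ∣ a ^ m - b ^ m)
    {q : ℕ} (hq : q.Prime) (hqm : q ∣ m) : m.primeFactors.card ≤ (PP a b m q).card := by
  have H : ∀ r ∈ m.primeFactors, ∃ p ∈ PP a b m q, rord a b p = if r = q then q else q * r := by
    intro r hr
    have hr' := Nat.prime_of_mem_primeFactors hr
    split_ifs with h
    · refine exP hb hab hc hm hq hqm ?_
      rw [Nat.factorization_eq_zero_of_not_dvd]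
      · simp
      · intro h; exact C q hq hqm (dvd_sub_of_dvd_gS hab h)
    · exact exP2 hb hab hc hm C hq hqm hr' (Nat.dvd_of_mem_primeFactors hr) (Ne.symm h)
  choose! f hf1 hf2 using H
  refine Finset.card_le_card_of_injOn f hf1 ?_
  intro r hr s hs h
  have h1 := hf2 r hr
  have h2 := hf2 s hs
  rw [h, h2] at h1
  have hr1 := (Nat.prime_of_mem_primeFactors hr).one_lt
  have hs1 := (Nat.prime_of_mem_primeFactors hs).one_lt
  have hq0 := hq.pos
  split_ifs at h1 with c1 c2 c2
  · rw [c1, c2]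
  · nlinarith
  · nlinarith
  · exact (Nat.eq_of_mul_eq_mul_left hq0 h1).symm

lemma cover {a b m : ℕ} (hb : 0 < b) (hab : b < a) (hc : Nat.Coprime a b) (hm : 0 < m)
    (C : ∀ r, r.Prime → r ∣ m → ¬ r ∣ a ^ m - b ^ m) :
    (gS a b m).primeFactors ⊆ m.primeFactors.biUnion (PP a b m) := by
  intro p hp
  have hpp := Nat.prime_of_mem_primeFactors hp
  have hpm := Nat.dvd_of_mem_primeFactors hp
  have hpd := dvd_sub_of_dvd_gS hab hpm
  have hn := not_dvd_of_dvd_sub hpp hab hc hm hpd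
  have ho := (rord_dvd hpp hab hn.2 _).1 hpd
  have h1 : rord a b p ≠ 1 := by
    intro h
    have h2 : p ∣ a - b := by simpa using (rord_dvd hpp hab hn.2 1).2 (by rw [h])
    exact C p hpp (dvd_of_dvd_gS hpp hab.le h2 hn.1 hpm) hpd
  obtain ⟨r, hr, hrd⟩ := Nat.exists_prime_and_dvd h1
  rw [Finset.mem_biUnion]
  exact ⟨r, Nat.mem_primeFactors.2 ⟨hr, hrd.trans ho, hm.ne'⟩, mem_PP hb hab hc hm hpp hpm rfl hrd⟩

/-- bound of v_r(gS n) -/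
lemma val_le {a b n r : ℕ} (hb : 0 < b) (hab : b < a) (hn : 0 < n)
    (hr : r.Prime) (hrn : ¬ r ∣ n) (ha' : ¬ r ∣ a) (hb' : ¬ r ∣ b) :
    r ^ (gS a b n).factorization r ∣ a ^ (r - 1) - b ^ (r - 1) := by
  have hr1 : r - 1 ≠ 0 := by have := hr.two_le; omega
  have h1 : r ^ (gS a b n).factorization r ∣ a ^ n - b ^ n :=
    dvd_sub_of_dvd_gS hab (Nat.ordProj_dvd _ _)
  have h2 : a ^ n - b ^ n ∣ (a ^ n) ^ (r - 1) - (b ^ n) ^ (r - 1) := by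
    rw [← gS_mul (Nat.pow_le_pow_left hab.le n)]; exact dvd_mul_left _ _
  have h3 := h1.trans h2
  have hle := Nat.pow_lt_pow_left hab hr1
  rw [← pow_mul, ← pow_mul, mul_comm n, pow_mul, pow_mul, ← gS_mul hle.le] at h3
  refine Nat.Coprime.dvd_of_dvd_mul_left (Nat.Coprime.pow_left _ ?_) h3
  rw [hr.coprime_iff_not_dvd]
  intro h4
  refine hrn (dvd_of_dvd_gS hr hle.le ?_ (fun h => ha' (hr.dvd_of_dvd_pow h)) h4)
  rw [rord_dvd hr hab hb']
  exact rord_dvd_pred hr ha' hb'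

lemma val_zero {a b n r : ℕ} (hab : b < a) (hc : Nat.Coprime a b) (hn : 0 < n)
    (hr : r.Prime) (h : r ∣ a ∨ r ∣ b) : (gS a b n).factorization r = 0 := by
  apply Nat.factorization_eq_zero_of_not_dvd
  intro h1
  have := not_dvd_of_dvd_sub hr hab hc hn (dvd_sub_of_dvd_gS hab h1)
  tauto

lemma sum_inv_le (J : Finset ℕ) (hJ : ∀ j ∈ J, 0 < j) :
    ∑ j ∈ J, (1 : ℝ) / j ≤ J.card / 6 + 29 / 20 := by
  set g : ℕ → ℝ := fun j => max ((1 : ℝ) / j - 1 / 6) 0 with hg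
  have h1 : ∑ j ∈ J, (1 : ℝ) / j ≤ ∑ j ∈ J, (1 / 6 + g j) := by
    refine Finset.sum_le_sum fun j _ => ?_
    have := le_max_left ((1 : ℝ) / j - 1 / 6) 0
    simp only [hg]; linarith
  rw [Finset.sum_add_distrib] at h1
  have h2 : ∑ j ∈ J, g j ≤ ∑ j ∈ J ∪ Finset.Icc 1 6, g j :=
    Finset.sum_le_sum_of_subset_of_nonneg Finset.subset_union_left (fun j _ _ => le_max_right _ _)
  have h3 : ∑ j ∈ Finset.Icc 1 6, g j = ∑ j ∈ J ∪ Finset.Icc 1 6, g j := by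
    refine Finset.sum_subset Finset.subset_union_right ?_
    intro j hj hj2
    have h4 : 0 < j := by
      rcases Finset.mem_union.1 hj with h | h
      · exact hJ j h
      · exact absurd h hj2
    have h5 : 6 ≤ j := by
      by_contra h
      exact hj2 (Finset.mem_Icc.2 ⟨h4, by omega⟩)
    simp only [hg]
    apply max_eq_right
    have : (1 : ℝ) / j ≤ 1 / 6 := by
      apply one_div_le_one_div_of_le (by norm_num); exact_mod_cast h5
    linarith
  have h4 : ∑ j ∈ Finset.Icc 1 6, g j = 29 / 20 := by
    have : Finset.Icc 1 6 = {1, 2, 3, 4, 5, 6} := by decide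
    rw [this]
    simp [hg]
    norm_num
  have h5 : ∑ j ∈ J, (1 / 6 : ℝ) = J.card / 6 := by simp; ring
  linarith

lemma sum_PP_le {r : ℕ} (hr : 0 < r) (P : Finset ℕ) (hP : ∀ p ∈ P, 1 < p ∧ 2 * r ∣ p - 1) :
    ∑ p ∈ P, (1 : ℝ) / ((p : ℝ) - 1) ≤ (P.card / 6 + 29 / 20) / (2 * r) := by
  have hinj : Set.InjOn (fun p => (p - 1) / (2 * r)) (P : Set ℕ) := by
    intro p hp s hs h
    have h1 := Nat.div_mul_cancel (hP p hp).2
    have h2 := Nat.div_mul_cancel (hP s hs).2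
    have h3 := (hP p hp).1
    have h4 := (hP s hs).1
    simp only at h
    rw [h] at h1
    omega
  have h1 := sum_inv_le (P.image (fun p => (p - 1) / (2 * r))) (by
    intro j hj
    obtain ⟨p, hp, rfl⟩ := Finset.mem_image.1 hj
    have h3 := (hP p hp).1
    exact Nat.div_pos (Nat.le_of_dvd (by omega) (hP p hp).2) (by omega))
  rw [Finset.sum_image hinj, Finset.card_image_of_injOn hinj] at h1
  have hr' : (0 : ℝ) < 2 * r := by positivity
  rw [le_div_iff₀ hr', Finset.sum_mul]
  refine le_trans (le_of_eq ?_) h1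
  refine Finset.sum_congr rfl fun p hp => ?_
  obtain ⟨h3, k, hk⟩ := hP p hp
  have h5 : (p : ℝ) - 1 = 2 * r * k := by
    have : p = 2 * r * k + 1 := by omega
    rw [this]; push_cast; ring
  have h6 : (p - 1) / (2 * r) = k := by
    rw [hk]; exact Nat.mul_div_cancel_left k (by omega)
  have hk0 : (k : ℝ) ≠ 0 := by
    intro h
    have : k = 0 := by exact_mod_cast h
    subst this; omega
  rw [h5, h6]
  field_simp

lemma sum_major (M : Finset ℕ) (F : ℕ → ℝ) (hM : ∀ r ∈ M, r.Prime ∧ r ≠ 2)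
    (h1 : ∀ r ∈ M, F r ≤ max ((49 : ℝ) / (40 * (r : ℝ))) ((49 : ℝ) / 440)) :
    ∑ r ∈ M, F r ≤ 49 / 40 * (1 / 3 + 1 / 5 + 1 / 7 + 1 / 11) + ((M.card : ℝ) - 4) * (49 / 440) := by
  set g : ℕ → ℝ := fun r => max (49 / (40 * r) - 49 / 440) 0 with hg
  have h2 : ∑ r ∈ M, F r ≤ ∑ r ∈ M, (49 / 440 + g r) := by
    refine Finset.sum_le_sum fun r hr => (h1 r hr).trans ?_
    simp only [hg]
    apply max_le
    · have := le_max_left ((49 : ℝ) / (40 * r) - 49 / 440) 0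
      linarith
    · have := le_max_right ((49 : ℝ) / (40 * r) - 49 / 440) 0
      linarith
  rw [Finset.sum_add_distrib] at h2
  set T : Finset ℕ := {3, 5, 7, 11} with hT
  have h3 : ∑ r ∈ M, g r ≤ ∑ r ∈ M ∪ T, g r :=
    Finset.sum_le_sum_of_subset_of_nonneg Finset.subset_union_left (fun j _ _ => le_max_right _ _)
  have h4 : ∑ r ∈ T, g r = ∑ r ∈ M ∪ T, g r := by
    refine Finset.sum_subset Finset.subset_union_right ?_
    intro r hr hr2
    have hr3 : r ∈ M := (Finset.mem_union.1 hr).resolve_right hr2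
    have h5 : 11 ≤ r := by
      by_contra h
      have hp := hM r hr3
      have h6 : r < 11 := by omega
      have := hp.1
      have := hp.2
      interval_cases r <;> first | (exact hr2 (by decide)) | omega | (revert this; norm_num; done) | (exact absurd hp.1 (by norm_num))
    simp only [hg]
    apply max_eq_right
    have : (49 : ℝ) / (40 * r) ≤ 49 / (40 * 11) := by
      have : (11 : ℝ) ≤ r := by exact_mod_cast h5
      gcongr
    linarith
  have h5 : ∑ r ∈ T, g r = 49 / 40 * (1 / 3 + 1 / 5 + 1 / 7 + 1 / 11) - 4 * (49 / 440) := by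
    simp [hg, hT]
    norm_num
  have h6 : ∑ r ∈ M, (49 / 440 : ℝ) = M.card * (49 / 440) := by simp
  linarith

lemma le_totient_exp (S : ℕ) :
    (S : ℝ) ≤ Nat.totient S * Real.exp (∑ p ∈ S.primeFactors, (1 : ℝ) / ((p : ℝ) - 1)) := by
  have h := Nat.totient_mul_prod_primeFactors S
  have hp : ∀ p ∈ S.primeFactors, (2 : ℝ) ≤ p := fun p hp => by
    exact_mod_cast (Nat.prime_of_mem_primeFactors hp).two_le
  have h1 : (Nat.totient S : ℝ) * ∏ p ∈ S.primeFactors, (p : ℝ) = S * ∏ p ∈ S.primeFactors, ((p : ℝ) - 1) := by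
    have h2 : ∏ p ∈ S.primeFactors, ((p : ℝ) - 1) = ((∏ p ∈ S.primeFactors, (p - 1) : ℕ) : ℝ) := by
      push_cast
      refine Finset.prod_congr rfl fun p hp => ?_
      rw [Nat.cast_sub (Nat.prime_of_mem_primeFactors hp).one_le]; simp
    rw [h2]
    have h4 := congrArg (fun t : ℕ => (t : ℝ)) h
    simp only [Nat.cast_mul] at h4
    rw [← h4, Nat.cast_prod]
  have hpos : 0 < ∏ p ∈ S.primeFactors, ((p : ℝ) - 1) :=
    Finset.prod_pos fun p h => by have := hp p h; linarith
  have h3 : ∏ p ∈ S.primeFactors, (p : ℝ) ≤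
      (∏ p ∈ S.primeFactors, ((p : ℝ) - 1)) * Real.exp (∑ p ∈ S.primeFactors, (1 : ℝ) / ((p : ℝ) - 1)) := by
    rw [Real.exp_sum, ← Finset.prod_mul_distrib]
    refine Finset.prod_le_prod (fun p h => by have := hp p h; linarith) fun p h => ?_
    have h4 := hp p h
    have h5 : (0 : ℝ) < p - 1 := by linarith
    have h6 := Real.add_one_le_exp ((1 : ℝ) / ((p : ℝ) - 1))
    calc (p : ℝ) = ((p : ℝ) - 1) * (1 / ((p : ℝ) - 1) + 1) := by field_simp; ring
      _ ≤ _ := by gcongr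
  have h7 : (S : ℝ) * ∏ p ∈ S.primeFactors, ((p : ℝ) - 1) ≤
      (Nat.totient S * Real.exp (∑ p ∈ S.primeFactors, (1 : ℝ) / ((p : ℝ) - 1))) *
        ∏ p ∈ S.primeFactors, ((p : ℝ) - 1) := by
    rw [← h1]
    refine (mul_le_mul_of_nonneg_left h3 (Nat.cast_nonneg _)).trans (le_of_eq ?_)
    ring
  exact le_of_mul_le_mul_right h7 hpos

lemma totient_pow_le (d k : ℕ) (hd : 0 < d) : d ^ (k + 1) = d ^ k * d ∧ d ^ k ≤ Nat.totient (d ^ (k + 1)) := by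
  refine ⟨pow_succ _ _, ?_⟩
  induction k with
  | zero => rw [pow_zero, zero_add, pow_one]; exact Nat.totient_pos.2 hd
  | succ k ih =>
    have h := Nat.totient_gcd_mul_totient_mul d (d ^ (k + 1))
    have hg : Nat.gcd d (d ^ (k + 1)) = d := Nat.gcd_eq_left (dvd_pow_self d (by omega))
    rw [hg, ← pow_succ', mul_assoc] at h
    have := Nat.eq_of_mul_eq_mul_left (Nat.totient_pos.2 hd) h
    rw [this, pow_succ d k]
    exact Nat.mul_le_mul_right _ ih

lemma gS_succ (a b k : ℕ) : gS a b (k + 1) = a * gS a b k + b ^ k := by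
  unfold gS
  rw [Finset.sum_range_succ', Finset.mul_sum]
  congr 1
  · refine Finset.sum_congr rfl fun i hi => ?_
    have : k + 1 - 1 - (i + 1) = k - 1 - i := by omega
    rw [this]; ring
  · simp

lemma gS_growth {a b n m : ℕ} (ha : 0 < a) (h : n < m) : a * gS a b n ≤ gS a b m := by
  induction m, h using Nat.le_induction with
  | base => rw [gS_succ]; omega
  | succ m _ ih =>
    rw [gS_succ]
    have : gS a b m ≤ a * gS a b m := Nat.le_mul_of_pos_left _ ha
    omega

lemma final_ineq {a b z d m n : ℕ} (hb : 0 < b) (hab : b < a) (hz : 0 < z) (hz80 : 4 * z ≤ 15 * Nat.totient z)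
    (hd : 0 < d) (hn : 0 < n) (hmn : n < m)
    (heq : Nat.totient (z * (d ^ (m - 1) * gS a b m)) = z * (d ^ (n - 1) * gS a b n)) :
    4 * (a : ℝ) ≤ 15 * Real.exp (∑ p ∈ (gS a b m).primeFactors, (1 : ℝ) / ((p : ℝ) - 1)) := by
  set E := Real.exp (∑ p ∈ (gS a b m).primeFactors, (1 : ℝ) / ((p : ℝ) - 1)) with hE
  have hEpos : 0 < E := Real.exp_pos _
  have h1 := le_totient_exp (gS a b m)
  rw [← hE] at h1
  have h2 : a * gS a b n ≤ gS a b m := gS_growth (by omega) hmn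
  obtain ⟨k, rfl⟩ : ∃ k, m = k + 2 := ⟨m - 2, by omega⟩
  obtain ⟨h3, h4⟩ := totient_pow_le d k hd
  have h5 : Nat.totient z * (Nat.totient (d ^ (k + 1)) * Nat.totient (gS a b (k + 2))) ≤
      z * (d ^ (n - 1) * gS a b n) := by
    rw [← heq]
    refine le_trans ?_ (Nat.totient_super_multiplicative _ _)
    exact Nat.mul_le_mul_left _ (Nat.totient_super_multiplicative _ _)
  have h6 : d ^ (n - 1) ≤ d ^ k := Nat.pow_le_pow_right hd (by omega)
  have h7 : Nat.totient z * (d ^ k * Nat.totient (gS a b (k + 2))) ≤ z * (d ^ k * gS a b n) := by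
    calc _ ≤ Nat.totient z * (Nat.totient (d ^ (k + 1)) * Nat.totient (gS a b (k + 2))) := by gcongr
      _ ≤ _ := h5
      _ ≤ _ := by gcongr
  have h8 : Nat.totient z * Nat.totient (gS a b (k + 2)) ≤ z * gS a b n := by
    have hk : 0 < d ^ k := by positivity
    refine le_of_mul_le_mul_left (a := d ^ k) ?_ hk
    calc _ = Nat.totient z * (d ^ k * Nat.totient (gS a b (k + 2))) := by ring
      _ ≤ _ := h7
      _ = _ := by ring
  have hg : 0 < gS a b n := gS_pos hb (by omega) hn
  have h9 : 0 < (z : ℝ) * gS a b n := by positivity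
  have hz80' : 4 * (z : ℝ) ≤ 15 * Nat.totient z := by exact_mod_cast hz80
  have h2' : (a : ℝ) * gS a b n ≤ gS a b (k + 2) := by exact_mod_cast h2
  have h8' : (Nat.totient z : ℝ) * Nat.totient (gS a b (k + 2)) ≤ z * gS a b n := by exact_mod_cast h8
  refine le_of_mul_le_mul_right ?_ h9
  calc 4 * (a : ℝ) * (z * gS a b n) = (4 * z) * (a * gS a b n) := by ring
    _ ≤ (15 * Nat.totient z) * (Nat.totient (gS a b (k + 2)) * E) := by
        exact mul_le_mul hz80' (h2'.trans h1) (by positivity) (by positivity)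
    _ = 15 * E * (Nat.totient z * Nat.totient (gS a b (k + 2))) := by ring
    _ ≤ 15 * E * (z * gS a b n) := by gcongr

lemma exp_b1 {t : ℝ} (h : t ≤ 47 / 50) : 15 * Real.exp t < 40 := by
  have h1 : Real.exp t ≤ Real.exp (1 + -(3 / 50)) := Real.exp_le_exp.2 (by linarith)
  rw [Real.exp_add, Real.exp_neg] at h1
  have h2 := Real.exp_one_lt_d9
  have h3 := Real.add_one_le_exp (3 / 50 : ℝ)
  have h4 : (Real.exp (3 / 50))⁻¹ ≤ (53 / 50 : ℝ)⁻¹ := by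
    apply inv_anti₀ (by norm_num); linarith
  have h5 : Real.exp 1 * (Real.exp (3 / 50))⁻¹ ≤ 2.7182818286 * (53 / 50 : ℝ)⁻¹ := by
    gcongr
  norm_num at h5
  linarith

lemma exp_b2 {t : ℝ} (h : t ≤ 6 / 5) : 15 * Real.exp t < 96 := by
  have h1 : Real.exp t ≤ Real.exp (1 + (1 / 5)) := Real.exp_le_exp.2 (by linarith)
  rw [Real.exp_add] at h1
  have h2 := Real.exp_one_lt_d9
  have h3 := Real.add_one_le_exp (-(1 / 5) : ℝ)
  rw [Real.exp_neg] at h3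
  have h4 : Real.exp (1 / 5) ≤ 5 / 4 := by
    have := inv_anti₀ (by norm_num) h3
    rw [inv_inv] at this
    norm_num at this ⊢
    linarith
  have h5 : Real.exp 1 * Real.exp (1 / 5) ≤ 2.7182818286 * (5 / 4) := by
    gcongr
  norm_num at h5
  linarith

lemma chk_use {q x y : ℕ} (hq : q.Prime) (h2 : q ≠ 2) (h : q < 173) (hx : x ≤ 80) (hy : y < x)
    (hqx : ¬ q ∣ x) :
    (q ^ 3 ∣ x ^ (q - 1) - y ^ (q - 1) → 10 ≤ x) ∧
    (q ^ 4 ∣ x ^ (q - 1) - y ^ (q - 1) → 24 ≤ x) ∧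
    ¬ q ^ 6 ∣ x ^ (q - 1) - y ^ (q - 1) := by
  have h5 : chk q x y = true :=
    List.all_eq_true.1 (List.all_eq_true.1 (List.all_eq_true.1 chk_all q (mem_oddPrimes hq h2 h)) x
      (List.mem_range.2 (by omega))) y (List.mem_range.2 hy)
  have i3 : q ^ 6 ∣ x ^ (q - 1) - y ^ (q - 1) → q ^ 4 ∣ x ^ (q - 1) - y ^ (q - 1) :=
    (pow_dvd_pow q (by norm_num)).trans
  have i4 : q ^ 4 ∣ x ^ (q - 1) - y ^ (q - 1) → q ^ 3 ∣ x ^ (q - 1) - y ^ (q - 1) :=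
    (pow_dvd_pow q (by norm_num)).trans
  rw [chk_eq] at h5
  simp only [Bool.or_eq_true, Bool.and_eq_true, beq_iff_eq, bne_iff_ne, ne_eq,
    Nat.ble_eq, ← Nat.dvd_iff_mod_eq_zero] at h5
  clear hx hy h
  generalize (q ^ 3 ∣ x ^ (q - 1) - y ^ (q - 1)) = A3 at *
  generalize (q ^ 4 ∣ x ^ (q - 1) - y ^ (q - 1)) = A4 at *
  generalize (q ^ 6 ∣ x ^ (q - 1) - y ^ (q - 1)) = A6 at *
  generalize (q ∣ x) = A0 at *
  tauto

lemma core {a b z d m n q : ℕ} (hb : 0 < b) (hab : b < a) (hc : Nat.Coprime a b) (ha80 : a ≤ 80)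
    (hz : 0 < z) (hz80 : z < 80) (hd : 0 < d) (hn : 0 < n) (hmn : n < m) (hcop : Nat.Coprime m n)
    (heq : Nat.totient (z * (d ^ (m - 1) * gS a b m)) = z * (d ^ (n - 1) * gS a b n))
    (hq : q.Prime) (hqm : q ∣ m) (hq173 : q < 173) : ¬ q ^ 3 ∣ a ^ (q - 1) - b ^ (q - 1) := by
  intro hdvd
  have hm : 0 < m := by omega
  have ha : 0 < a := by omega
  have hgm : gS a b m ≠ 0 := (gS_pos hb ha hm).ne'
  have hgn : gS a b n ≠ 0 := (gS_pos hb ha hn).ne'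
  have K : ∀ r, r.Prime →
      (PP a b m r).card + (gS a b m).factorization r ≤ 1 + (gS a b n).factorization r := by
    intro r hr
    have hX : z * (d ^ (m - 1) * gS a b m) ≠ 0 := by positivity
    have h1 := (totient_val (r := r) hX).resolve_right (by simpa using hr)
    have h2 : PP a b m r ⊆ (z * (d ^ (m - 1) * gS a b m)).primeFactors.filter (fun p => r ∣ p - 1) := by
      refine Finset.filter_subset_filter _ (Nat.primeFactors_mono ?_ hX)
      exact dvd_mul_of_dvd_right (dvd_mul_left _ _) _
    have h3 := Finset.card_le_card h2
    have hdm : d ^ (m - 1) ≠ 0 := by positivity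
    have hdn : d ^ (n - 1) ≠ 0 := by positivity
    rw [heq, Nat.factorization_mul hz.ne' (mul_ne_zero hdm hgm), Nat.factorization_mul hdm hgm,
      Nat.factorization_mul hz.ne' (mul_ne_zero hdn hgn), Nat.factorization_mul hdn hgn,
      Nat.factorization_pow, Nat.factorization_pow] at h1
    simp only [Finsupp.add_apply, Finsupp.smul_apply, smul_eq_mul] at h1
    have h4 : (n - 1) * d.factorization r ≤ (m - 1) * d.factorization r :=
      Nat.mul_le_mul_right _ (by omega)
    omega
  have C : ∀ r, r.Prime → r ∣ m → ¬ r ∣ a ^ m - b ^ m :=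
    fun r hr hrm => C1 hb hab hc hm hn hcop K hr hrm
  have hrn : ∀ r, r.Prime → r ∣ m → ¬ r ∣ n := fun r hr hrm h =>
    Nat.not_coprime_of_dvd_of_dvd hr.one_lt hrm h hcop
  have C' : ∀ r, r.Prime → r ∣ m → ¬ r ∣ a - b := fun r hr hrm h => by
    refine C r hr hrm (h.trans ?_)
    rw [← gS_mul hab.le]; exact dvd_mul_left _ _
  have hq2 : q ≠ 2 := by
    rintro rfl
    refine C' 2 hq hqm (dvd_trans ?_ (by simpa using hdvd))
    norm_num
  have hqnd := not_dvd_of_dvd_sub hq hab hc (by have := hq.two_le; omega)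
    ((dvd_pow_self q (by norm_num)).trans hdvd)
  -- `m` is odd
  have hodd : ¬ 2 ∣ m := by
    intro h2
    have h3 := card_PP_ge hb hab hc hm C Nat.prime_two h2
    have h4 : 2 ≤ m.primeFactors.card := by
      have : ({2, q} : Finset ℕ) ⊆ m.primeFactors := by
        intro t ht
        rw [Finset.mem_insert, Finset.mem_singleton] at ht
        rcases ht with rfl | rfl
        · exact Nat.mem_primeFactors.2 ⟨Nat.prime_two, h2, hm.ne'⟩
        · exact Nat.mem_primeFactors.2 ⟨hq, hqm, hm.ne'⟩
      have h5 := Finset.card_le_card this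
      rwa [Finset.card_pair (Ne.symm hq2)] at h5
    have h5 : (gS a b n).factorization 2 = 0 := by
      by_cases h6 : 2 ∣ a ∨ 2 ∣ b
      · exact val_zero hab hc hn Nat.prime_two h6
      · exact absurd (by omega) (C' 2 Nat.prime_two h2)
    have := K 2 Nat.prime_two
    omega
  -- number of prime factors
  have hw := card_PP_ge hb hab hc hm C hq hqm
  have hKq := K q hq
  have hval := val_le hb hab hn hq (hrn q hq hqm) hqnd.1 hqnd.2
  obtain ⟨u3, u4, u6⟩ := chk_use hq hq2 hq173 ha80 hab hqnd.1
  -- the sums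
  have hF : ∀ r ∈ m.primeFactors, ∑ p ∈ PP a b m r, (1 : ℝ) / ((p : ℝ) - 1) ≤
      max ((49 : ℝ) / (40 * (r : ℝ))) ((49 : ℝ) / 440) := by
    intro r hrm'
    have hr := Nat.prime_of_mem_primeFactors hrm'
    have hrm := Nat.dvd_of_mem_primeFactors hrm'
    have hr2 : r ≠ 2 := by rintro rfl; exact hodd hrm
    have hP : ∀ p ∈ PP a b m r, 1 < p ∧ 2 * r ∣ p - 1 := by
      intro p hp
      obtain ⟨h1, h2⟩ := Finset.mem_filter.1 hp
      have hpp := Nat.prime_of_mem_primeFactors h1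
      refine ⟨hpp.one_lt, ?_⟩
      have hp2 : p ≠ 2 := by
        rintro rfl
        have := Nat.le_of_dvd (by norm_num) h2
        have := hr.two_le
        omega
      refine Nat.Coprime.mul_dvd_of_dvd_of_dvd ((Nat.coprime_primes Nat.prime_two hr).2 (Ne.symm hr2)) ?_ h2
      have := hpp.eq_two_or_odd
      omega
    refine (sum_PP_le hr.pos _ hP).trans ?_
    have hKr := K r hr
    have hr0 : (0 : ℝ) < r := by exact_mod_cast hr.pos
    by_cases hr173 : r < 173
    · refine le_max_of_le_left ?_
      have h6 : (PP a b m r).card ≤ 6 := by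
        by_cases hd : r ∣ a ∨ r ∣ b
        · rw [val_zero hab hc hn hr hd] at hKr; omega
        · push Not at hd
          have h7 := val_le hb hab hn hr (hrn r hr hrm) hd.1 hd.2
          have h8 := (chk_use hr hr2 hr173 ha80 hab hd.1).2.2
          have : ¬ 6 ≤ (gS a b n).factorization r := fun h => h8 ((pow_dvd_pow r h).trans h7)
          omega
      have h6' : ((PP a b m r).card : ℝ) ≤ 6 := by exact_mod_cast h6
      rw [div_le_div_iff₀ (by positivity) (by positivity)]
      nlinarith
    · refine le_max_of_le_right ?_
      have nd : ∀ t, 0 < t → t ≤ 80 → ¬ r ∣ t := fun t h1 h2 h3 => by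
        have := Nat.le_of_dvd h1 h3; omega
      have h7 := val_le hb hab hn hr (hrn r hr hrm) (nd a ha ha80) (nd b hb (by omega))
      have h8 : b ^ (r - 1) < a ^ (r - 1) := Nat.pow_lt_pow_left hab (by omega)
      have h9 := Nat.le_of_dvd (by omega) h7
      have h10 : a ^ (r - 1) ≤ r ^ (r - 1) := Nat.pow_le_pow_left (by omega) _
      have h11 : 0 < b ^ (r - 1) := by positivity
      have h12 := (Nat.pow_lt_pow_iff_right hr.one_lt).1
        (show r ^ (gS a b n).factorization r < r ^ (r - 1) by omega)
      have h13 : (PP a b m r).card ≤ r := by omega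
      have h13' : ((PP a b m r).card : ℝ) ≤ r := by exact_mod_cast h13
      have h14 : (173 : ℝ) ≤ r := by exact_mod_cast (by omega : 173 ≤ r)
      rw [div_le_div_iff₀ (by positivity) (by positivity)]
      nlinarith
  have hM := sum_major m.primeFactors (fun r => ∑ p ∈ PP a b m r, (1 : ℝ) / ((p : ℝ) - 1))
    (fun r hr => ⟨Nat.prime_of_mem_primeFactors hr, by
      rintro rfl; exact hodd (Nat.dvd_of_mem_primeFactors hr)⟩) hF
  have hnn : ∀ p : ℕ, p ≠ 0 → (0 : ℝ) ≤ 1 / ((p : ℝ) - 1) := fun p hp => by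
    have : (1 : ℝ) ≤ p := by exact_mod_cast Nat.pos_of_ne_zero hp
    exact one_div_nonneg.2 (by linarith)
  have hPP0 : ∀ r, ∀ p ∈ PP a b m r, p ≠ 0 := fun r p hp =>
    (Nat.prime_of_mem_primeFactors (Finset.mem_filter.1 hp).1).ne_zero
  have hS : ∑ p ∈ (gS a b m).primeFactors, (1 : ℝ) / ((p : ℝ) - 1) ≤
      ∑ r ∈ m.primeFactors, ∑ p ∈ PP a b m r, (1 : ℝ) / ((p : ℝ) - 1) := by
    have hsub : ∀ p ∈ (gS a b m).primeFactors, (1 : ℝ) / ((p : ℝ) - 1) ≤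
        ∑ r ∈ m.primeFactors, if p ∈ PP a b m r then (1 : ℝ) / ((p : ℝ) - 1) else 0 := by
      intro p hp
      obtain ⟨r, hr, hpr⟩ := Finset.mem_biUnion.1 (cover hb hab hc hm C hp)
      have hp0 := hnn p (Nat.prime_of_mem_primeFactors hp).ne_zero
      have h1 := Finset.single_le_sum (s := m.primeFactors)
        (f := fun r => if p ∈ PP a b m r then (1 : ℝ) / ((p : ℝ) - 1) else 0)
        (fun i _ => by split_ifs <;> [exact hp0; exact le_rfl]) hr
      simpa only [hpr, if_true] using h1
    refine (Finset.sum_le_sum hsub).trans ?_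
    rw [Finset.sum_comm]
    refine Finset.sum_le_sum fun r _ => ?_
    rw [← Finset.sum_filter]
    refine Finset.sum_le_sum_of_subset_of_nonneg ?_ (fun p hp _ => hnn p (hPP0 r p hp))
    intro p hp
    exact (Finset.mem_filter.1 hp).2
  have hfin := final_ineq hb hab hz (tot80 z hz80) hd hn hmn heq
  have h10 := u3 hdvd
  by_cases h24 : 24 ≤ a
  · have h5 : ¬ 6 ≤ (gS a b n).factorization q := fun h => u6 ((pow_dvd_pow q h).trans hval)
    have h6 : m.primeFactors.card ≤ 6 := by omega
    have h6' : (m.primeFactors.card : ℝ) ≤ 6 := by exact_mod_cast h6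
    have h7 := exp_b2 (t := ∑ p ∈ (gS a b m).primeFactors, (1 : ℝ) / ((p : ℝ) - 1)) (by
      refine (hS.trans hM).trans ?_
      linarith)
    have : (24 : ℝ) ≤ a := by exact_mod_cast h24
    linarith
  · have h5 : ¬ 4 ≤ (gS a b n).factorization q := fun h => h24 (u4 ((pow_dvd_pow q h).trans hval))
    have h6 : m.primeFactors.card ≤ 4 := by omega
    have h6' : (m.primeFactors.card : ℝ) ≤ 4 := by exact_mod_cast h6
    have h7 := exp_b1 (t := ∑ p ∈ (gS a b m).primeFactors, (1 : ℝ) / ((p : ℝ) - 1)) (by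
      refine (hS.trans hM).trans ?_
      linarith)
    have : (10 : ℝ) ≤ a := by exact_mod_cast h10
    linarith

theorem pow_three_not_dvd (x y z m n : ℕ) (hx : 0 < x) (hy : 0 < y) (hz : 0 < z)
    (hm : 0 < m) (hn : 0 < n) (hxy : y < x) (hzxy : z ≤ x - y)
    (hgcd : Nat.gcd m n = 1) (hmn : n < m)
    (heq : Nat.totient (z * ((x ^ m - y ^ m) / (x - y))) =
      z * ((x ^ n - y ^ n) / (x - y)))
    (hx80 : x ≤ 80)
    (d₁ x₁ y₁ : ℕ) (hd₁ : d₁ = Nat.gcd x y) (hx₁ : x₁ = x / d₁) (hy₁ : y₁ = y / d₁)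
    (q : ℕ) (hq : q.Prime) (hqm : q ∣ m) (hq173 : q < 173) :
    ¬ q ^ 3 ∣ x₁ ^ (q - 1) - y₁ ^ (q - 1) := by
  have hd : 0 < d₁ := hd₁ ▸ Nat.gcd_pos_of_pos_left _ hx
  have ex : x = d₁ * x₁ := by
    rw [hx₁, Nat.mul_div_cancel' (hd₁ ▸ Nat.gcd_dvd_left x y)]
  have ey : y = d₁ * y₁ := by
    rw [hy₁, Nat.mul_div_cancel' (hd₁ ▸ Nat.gcd_dvd_right x y)]
  have hc : Nat.Coprime x₁ y₁ := by
    rw [hx₁, hy₁, hd₁]; exact Nat.coprime_div_gcd_div_gcd (hd₁ ▸ hd)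
  have key : ∀ k, (x ^ k - y ^ k) / (x - y) = d₁ ^ (k - 1) * gS x₁ y₁ k := by
    intro k
    rw [← gS_scale, ← ex, ← ey]
    exact Nat.div_eq_of_eq_mul_left (by omega) (gS_mul hxy.le k).symm
  rw [key, key] at heq
  have hb : 0 < y₁ := Nat.pos_of_ne_zero (by rintro h; rw [h] at ey; omega)
  have hab : y₁ < x₁ := by
    rw [ex, ey] at hxy; exact Nat.lt_of_mul_lt_mul_left hxy
  have ha80 : x₁ ≤ 80 := by
    have : x₁ ≤ d₁ * x₁ := Nat.le_mul_of_pos_left _ hd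
    omega
  exact core hb hab hc ha80 hz (by omega) hd hn hmn hgcd heq hq hqm hq173
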